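/- Let N ≥ 1, let S ∈ ℂ^{N×N} be Hermitian positive definite, and let α > 0, β > 0, δ ≥ 0. Then, with ‖y‖_S² := y^H S y, the function y ↦ (‖y‖_S² + δ)^{α−1} (‖y‖_S²)^{1−N} exp(−(‖y‖_S² + δ)/β) is integrable on ℂ^N with respect to Lebesgue measure (identifying ℂ^N with ℝ^{2N}), and ∫_{ℂ^N} (‖y‖_S² + δ)^{α−1} (‖y‖_S²)^{1−N} e^{−(‖y‖_S² + δ)/β} dy = (π^N β^α / (Γ(N) det S)) · ∫_{δ/β}^{∞} t^{α−1} e^{−t} dt, where Γ(N) = (N−1)! and det S is a positive real number. -/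

import Mathlib

open Matrix MeasureTheory ComplexOrder

/-- Radial integration on `ℂ^N` for a positive definite Hermitian form: a function of `yᴴ S y` is
integrable iff its radial profile is, with integral `2 π^N / ((N-1)! det S)` times the
one-dimensional one. -/
lemma integrable_integral_comp_quadForm (N : ℕ) (hN : 1 ≤ N) (S : Matrix (Fin N) (Fin N) ℂ)
    (hS : S.PosDef) (g : ℝ → ℝ) :
    (Integrable (fun y : Fin N → ℂ => g (star y ⬝ᵥ (S *ᵥ y)).re) ↔
      IntegrableOn (fun r : ℝ => r ^ (2 * N - 1) * g (r ^ 2)) (Set.Ioi 0)) ∧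
    ∫ y : Fin N → ℂ, g (star y ⬝ᵥ (S *ᵥ y)).re =
      2 * Real.pi ^ N / ((N - 1).factorial * S.det.re) *
        ∫ r in Set.Ioi (0 : ℝ), r ^ (2 * N - 1) * g (r ^ 2) := by
  have : NeZero N := ⟨by omega⟩
  obtain ⟨B, rfl⟩ : ∃ B, S = Bᴴ * B := by
    open scoped MatrixOrder in
    exact CStarAlgebra.nonneg_iff_eq_star_mul_self.mp hS.posSemidef.nonneg
  have hdetS : ((Bᴴ * B).det).re = ‖B.det‖ ^ 2 := by
    rw [det_mul, det_conjTranspose, ← Complex.normSq_eq_norm_sq, RCLike.star_def,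
      ← Complex.normSq_eq_conj_mul_self, Complex.ofReal_re]
  have hB : B.det ≠ 0 := by
    intro h
    have := hS.det_pos
    simp [det_mul, h] at this
  let M : (Fin N → ℂ) ≃ₗ[ℂ] (Fin N → ℂ) :=
    Matrix.toLinearEquiv' B (B.invertibleOfIsUnitDet hB.isUnit)
  let L : (Fin N → ℂ) ≃L[ℝ] EuclideanSpace ℂ (Fin N) :=
    ((M.trans (WithLp.linearEquiv 2 ℂ (Fin N → ℂ)).symm).restrictScalars ℝ).toContinuousLinearEquiv
  have hL (y) : L y = WithLp.toLp 2 (B *ᵥ y) := rfl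
  have hq (y : Fin N → ℂ) : (star y ⬝ᵥ ((Bᴴ * B) *ᵥ y)).re = ‖L y‖ ^ 2 := by
    rw [hL, EuclideanSpace.norm_sq_eq, ← mulVec_mulVec, dotProduct_mulVec, vecMul_conjTranspose,
      star_star, dotProduct, Complex.re_sum]
    refine Finset.sum_congr rfl fun i _ => ?_
    rw [← Complex.normSq_eq_norm_sq, Pi.star_apply, RCLike.star_def,
      ← Complex.normSq_eq_conj_mul_self, Complex.ofReal_re]
  have hemb : MeasurableEmbedding L := L.toHomeomorph.measurableEmbedding
  let μ : Measure (EuclideanSpace ℂ (Fin N)) := Measure.map L volume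
  have : μ.IsAddHaarMeasure := L.isAddHaarMeasure_map _
  have hdim : Module.finrank ℝ (EuclideanSpace ℂ (Fin N)) = 2 * N := by
    rw [← L.toLinearEquiv.finrank_eq]
    simp [Module.finrank_pi_fintype ℝ, mul_comm]
  have hball : μ.real (Metric.ball 0 1) = Real.pi ^ N / (N.factorial * ‖B.det‖ ^ 2) := by
    have hdet : LinearMap.det ((Matrix.toLin' B).restrictScalars ℝ) = ‖B.det‖ ^ 2 := by
      rw [LinearMap.det_restrictScalars, Algebra.norm_complex_eq, LinearMap.det_toLin']
      exact Complex.normSq_eq_norm_sq _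
    have hpre : L ⁻¹' Metric.ball 0 1 = ((Matrix.toLin' B).restrictScalars ℝ) ⁻¹'
        {x : Fin N → ℂ | ∑ i, ‖x i‖ ^ (2 : ℝ) < 1} := by
      ext y
      simp [hL, EuclideanSpace.norm_eq, Real.sqrt_lt' one_pos]
    rw [Measure.real, hemb.map_apply, hpre, Measure.addHaar_preimage_linearMap _ (by
      rw [hdet]; positivity), hdet, Complex.volume_sum_rpow_lt_one _ one_le_two]
    have h1 : (2 : ℝ) * (Fintype.card (Fin N)) / 2 + 1 = N + 1 := by simp
    have h2 : (2 : ℝ) / 2 + 1 = 2 := by norm_num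
    rw [h1, h2, Real.Gamma_two, Real.Gamma_nat_eq_factorial, ENNReal.toReal_mul,
      ENNReal.toReal_ofReal (by positivity), ENNReal.toReal_ofReal (by positivity),
      abs_of_nonneg (by positivity), Fintype.card_fin]
    field_simp
  simp_rw [hq]
  constructor
  · have := integrable_fun_norm_addHaar μ (f := fun r => g (r ^ 2))
    rw [hdim, hemb.integrable_map_iff] at this
    exact this
  · have := integral_fun_norm_addHaar μ (fun r => g (r ^ 2))
    rw [hemb.integral_map, hdim, hball] at this
    rw [this, hdetS, nsmul_eq_mul, smul_eq_mul, ← mul_assoc]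
    simp only [smul_eq_mul]
    congr 1
    obtain ⟨n, rfl⟩ : ∃ n, N = n + 1 := ⟨N - 1, by omega⟩
    rw [Nat.add_sub_cancel, Nat.factorial_succ]
    push_cast
    field_simp

/-- Normalization of the Lapidoth–Moser regularized-Gamma family: for
Hermitian positive definite `S`, `α, β > 0`, `δ ≥ 0`, the function
`y ↦ (‖y‖_S² + δ)^(α-1) (‖y‖_S²)^(1-N) exp(-(‖y‖_S² + δ)/β)` is integrable on
`ℂ^N` w.r.t. Lebesgue measure and its integral equals
`π^N β^α / (Γ(N) det S) · Γ(α, δ/β)` with `Γ(N) = (N-1)!`. -/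
theorem stmt_9 (N : ℕ) (hN : 1 ≤ N) (S : Matrix (Fin N) (Fin N) ℂ) (hS : S.PosDef)
    (α β δ : ℝ) (hα : 0 < α) (hβ : 0 < β) (hδ : 0 ≤ δ) :
    let q : (Fin N → ℂ) → ℝ := fun y => (star y ⬝ᵥ (S *ᵥ y)).re
    let f : (Fin N → ℂ) → ℝ := fun y =>
      (q y + δ) ^ (α - 1) * (q y) ^ ((1 : ℝ) - N) * Real.exp (-(q y + δ) / β)
    Integrable f volume ∧
      (∫ y, f y) = (Real.pi ^ N * β ^ α / (((N - 1).factorial : ℝ) * S.det.re)) *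
        ∫ t in Set.Ioi (δ / β), t ^ (α - 1) * Real.exp (-t) := by
  intro q f
  obtain ⟨hint, heq⟩ := integrable_integral_comp_quadForm N hN S hS fun s =>
    (s + δ) ^ (α - 1) * s ^ ((1 : ℝ) - N) * Real.exp (-(s + δ) / β)
  let φ : ℝ → ℝ := fun r => (r ^ 2 + δ) / β
  have himage : φ '' Set.Ioi 0 = Set.Ioi (δ / β) := by
    ext t
    simp only [φ, Set.mem_image, Set.mem_Ioi]
    constructor
    · rintro ⟨r, hr, rfl⟩
      gcongr
      nlinarith
    · intro ht
      have ht' : 0 < t * β - δ := sub_pos.mpr ((div_lt_iff₀ hβ).mp ht)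
      refine ⟨√(t * β - δ), Real.sqrt_pos.mpr ht', ?_⟩
      rw [Real.sq_sqrt ht'.le]
      field_simp
      ring
  have hderiv : ∀ r ∈ Set.Ioi (0 : ℝ), HasDerivWithinAt φ (2 * r / β) (Set.Ioi 0) r := by
    intro r _
    simpa using ((((hasDerivAt_id r).pow 2).add_const δ).div_const β).hasDerivWithinAt
  have hinj : Set.InjOn φ (Set.Ioi 0) := by
    intro a ha b hb hab
    have : a ^ 2 = b ^ 2 := by simpa [φ, hβ.ne'] using hab
    exact (sq_eq_sq₀ (le_of_lt ha) (le_of_lt hb)).mp this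
  have hcongr : Set.EqOn (fun r : ℝ => r ^ (2 * N - 1) *
        ((r ^ 2 + δ) ^ (α - 1) * (r ^ 2) ^ ((1 : ℝ) - N) * Real.exp (-(r ^ 2 + δ) / β)))
      (fun r => (β ^ α / 2) * (|2 * r / β| • (φ r ^ (α - 1) * Real.exp (-φ r)))) (Set.Ioi 0) := by
    intro r hr
    have hr : 0 < r := hr
    have hpow : r ^ (2 * N - 1) * (r ^ 2) ^ ((1 : ℝ) - N) = r := by
      rw [← Real.rpow_natCast, ← Real.rpow_natCast, ← Real.rpow_mul hr.le, ← Real.rpow_add hr,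
        Nat.cast_sub (by omega)]
      push_cast
      ring_nf
      exact Real.rpow_one r
    have hβα : β ^ α = β ^ (α - 1) * β := by rw [Real.rpow_sub_one hβ.ne']; field_simp
    simp only [φ, smul_eq_mul]
    rw [abs_of_pos (by positivity), Real.div_rpow (by positivity) hβ.le, hβα, ← neg_div]
    have := (Real.rpow_pos_of_pos hβ (α - 1)).ne'
    calc _ = (r ^ (2 * N - 1) * (r ^ 2) ^ ((1 : ℝ) - N)) *
          ((r ^ 2 + δ) ^ (α - 1) * Real.exp (-(r ^ 2 + δ) / β)) := by ring
      _ = _ := by rw [hpow]; field_simp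
  have hgamma : IntegrableOn (fun t : ℝ => t ^ (α - 1) * Real.exp (-t)) (Set.Ioi (δ / β)) := by
    refine ((Real.GammaIntegral_convergent hα).mono_set
      (Set.Ioi_subset_Ioi (by positivity))).congr_fun (fun t _ => mul_comm _ _) measurableSet_Ioi
  constructor
  · refine hint.mpr (IntegrableOn.congr_fun ?_ hcongr.symm measurableSet_Ioi)
    rw [← himage, integrableOn_image_iff_integrableOn_abs_deriv_smul measurableSet_Ioi
      hderiv hinj] at hgamma
    exact hgamma.const_mul _
  · refine heq.trans ?_
    rw [setIntegral_congr_fun measurableSet_Ioi hcongr, integral_const_mul,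
      ← integral_image_eq_integral_abs_deriv_smul measurableSet_Ioi hderiv hinj
        (fun t => t ^ (α - 1) * Real.exp (-t)), himage]
    ring
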